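/- (Theorem 3.2, injectivity of β_L) The decomposition map β_L : S_{L,M} → S^{(b)}_{L,M} × S^{(f)}_L, η ↦ (c(η), d(η)), is injective: if η, ζ ∈ S_{L,M} satisfy c(η) = c(ζ) and d(η) = d(ζ), then η = ζ. -/

import Mathlib

namespace BBS

attribute [local instance] Classical.propDecidable

noncomputable section

/-- Carrier sequence with initial load `m` for box capacity `L`. -/
def carrierM (L m : ℤ) (η : ℕ → ℤ) : ℕ → ℤ
  | 0 => m
  | j + 1 => η j + max 0 (η j + carrierM L m η j - L)

/-- Carrier sequence (initial load `0`). -/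
def carrier (L : ℤ) (η : ℕ → ℤ) : ℕ → ℤ := carrierM L 0 η

/-- Time evolution `T_L`. -/
def evol (L : ℤ) (η : ℕ → ℤ) (j : ℕ) : ℤ := min (L - η j) (carrier L η j)

/-- Time evolution `T_1^m` on binary sequences. -/
def evolOne (m : ℤ) (w : ℕ → ℤ) (j : ℕ) : ℤ := min (1 - w j) (carrierM 1 m w j)

/-- Membership in `S_{L,M}`. -/
def mem_S (L M : ℤ) (η : ℕ → ℤ) : Prop :=
  (∃ N : ℕ, ∀ j, N ≤ j → η j = 0) ∧
  (∀ j, -M ≤ η j ∧ η j ≤ L + M) ∧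
  η 0 ≤ 0 ∧
  (∀ j, max (-η j) (η j - L) ≤ M) ∧
  (∃ j, max (-η j) (η j - L) = M) ∧
  (∀ i : ℕ, ∑ j ∈ Finset.range (i + 2), η j ≤ ∑ j ∈ Finset.range (i + 1), (L - η j))

/-- Auxiliary sequence for the backward carrier. -/
def backAux (L : ℤ) (η : ℕ → ℤ) (x : ℕ) : ℕ → ℤ
  | 0 => 0
  | n + 1 => η (x - n - 1) + max 0 (η (x - n - 1) + backAux L η x n - L)

/-- Backward carrier `ū` computed from the index `x`. -/
def backCarrier (L : ℤ) (η : ℕ → ℤ) (x j : ℕ) : ℤ :=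
  if x ≤ j then 0 else backAux L η x (x - j)

/-- Reverse time evolution `R_L` computed from the index `x`. -/
def revol (L : ℤ) (η : ℕ → ℤ) (x j : ℕ) : ℤ :=
  if j < x then min (L - η j) (backCarrier L η x (j + 1)) else 0

/-- The concatenated word sequence `r_K(η)`. -/
def rSeq (L M : ℕ) (K : Set ℕ) (η : ℕ → ℤ) (n : ℕ) : ℤ :=
  if (n / (L + 2 * M) ∈ K ∧ ((n % (L + 2 * M) : ℕ) : ℤ) < η (n / (L + 2 * M)) + M) ∨
      (n / (L + 2 * M) ∉ K ∧
        (L : ℤ) + 2 * M - (η (n / (L + 2 * M)) + M) ≤ ((n % (L + 2 * M) : ℕ) : ℤ))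
  then 1 else 0

/-- The concatenated word sequence `l_K(η)`. -/
def lSeq (L M : ℕ) (K : Set ℕ) (η : ℕ → ℤ) (n : ℕ) : ℤ :=
  if (n / (L + 2 * M) ∈ K ∧
        (L : ℤ) + 2 * M - (η (n / (L + 2 * M)) + M) ≤ ((n % (L + 2 * M) : ℕ) : ℤ)) ∨
      (n / (L + 2 * M) ∉ K ∧ ((n % (L + 2 * M) : ℕ) : ℤ) < η (n / (L + 2 * M)) + M)
  then 1 else 0

/-- Soliton flag sequence `a(η)`. -/
def flag (L : ℤ) (η : ℕ → ℤ) : ℕ → ℤ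
  | 0 => 0
  | j + 1 =>
    if η j + η (j + 1) < L then 0
    else if η j + η (j + 1) = L then flag L η j else 1

/-- Primed soliton flag sequence `a′(η)` (with the convention `a′_{-1} = 0`). -/
def flag' (L : ℤ) (η : ℕ → ℤ) : ℕ → ℤ
  | 0 => if η 0 + η 1 < L then 0 else if η 0 + η 1 = L then 0 else 1
  | j + 1 =>
    if η (j + 1) + η (j + 2) < L then 0
    else if η (j + 1) + η (j + 2) = L then flag' L η j else 1

/-- `I(η)`: right ends of contiguous 1-segments. -/
def Iset (L : ℤ) (η : ℕ → ℤ) : Set ℕ := {j | flag L η j = 1 ∧ flag L η (j + 1) = 0}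

/-- `I′(η)`: left ends of contiguous right-1-segments. -/
def Iset' (L : ℤ) (η : ℕ → ℤ) : Set ℕ :=
  {j | (∀ k, j = k + 1 → flag' L η k = 0) ∧ flag' L η j = 1}

def marked (L : ℤ) (η : ℕ → ℤ) (j : ℕ) : Prop := j ∈ Iset L η ∨ j + 1 ∈ Iset L η

def marked' (L : ℤ) (η : ℕ → ℤ) (j : ℕ) : Prop :=
  j ∈ Iset' L η ∨ ∃ k, j = k + 1 ∧ k ∈ Iset' L η

/-- Arc-count sequence `b̃(η)`. -/
def btilde (L M : ℕ) (η : ℕ → ℤ) (j : ℕ) : ℤ :=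
  if marked (L : ℤ) η j then 0
  else min (η j + M) ((L : ℤ) + 2 * M - (η (j + 1) + M))

/-- `b̃_{j-1}` with the convention `b̃_{-1} = 0`. -/
def bprev (L M : ℕ) (η : ℕ → ℤ) : ℕ → ℤ
  | 0 => 0
  | j + 1 => btilde L M η j

/-- Primed arc-count sequence `b̃′(η)`. -/
def btilde' (L M : ℕ) (η : ℕ → ℤ) : ℕ → ℤ
  | 0 => if marked' (L : ℤ) η 0 then 0 else η 0 + M
  | j + 1 =>
    if marked' (L : ℤ) η (j + 1) then 0
    else min (η (j + 1) + M) ((L : ℤ) + 2 * M - (η j + M))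

/-- Background sequence `c(η)`: subsequence of `b̃` on unmarked indices, lowered by `M`. -/
def bg (L M : ℕ) (η : ℕ → ℤ) (j : ℕ) : ℤ :=
  btilde L M η (Nat.nth (fun i => ¬ marked (L : ℤ) η i) j) - M

/-- Primed background sequence `c′(η)`. -/
def bg' (L M : ℕ) (η : ℕ → ℤ) (j : ℕ) : ℤ :=
  btilde' L M η (Nat.nth (fun i => ¬ marked' (L : ℤ) η i) j) - M

/-- Length of the word corresponding to box `j` in `d̃(η)`. -/
def wordLen (L M : ℕ) (η : ℕ → ℤ) (j : ℕ) : ℕ :=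
  if j ∈ Iset (L : ℤ) η then L + 2 * M
  else ((L : ℤ) + 2 * M - bprev L M η j - btilde L M η j).toNat

def wordStart (L M : ℕ) (η : ℕ → ℤ) (j : ℕ) : ℕ :=
  ∑ k ∈ Finset.range j, wordLen L M η k

/-- Raised soliton word sequence `d̃(η)`. -/
def dTilde (L M : ℕ) (η : ℕ → ℤ) (n : ℕ) : ℤ :=
  if ∃ j, wordStart L M η j ≤ n ∧ n < wordStart L M η (j + 1) ∧
      ((j ∈ Iset (L : ℤ) η ∧ ((n - wordStart L M η j : ℕ) : ℤ) < η j + M) ∨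
        (j ∉ Iset (L : ℤ) η ∧
          (L : ℤ) + 2 * M - (η j + M) - bprev L M η j ≤ ((n - wordStart L M η j : ℕ) : ℤ)))
  then 1 else 0

/-- Length of the word corresponding to box `j` in `d̃′(η)`. -/
def wordLen' (L M : ℕ) (η : ℕ → ℤ) (j : ℕ) : ℕ :=
  if j ∈ Iset' (L : ℤ) η then L + 2 * M
  else ((L : ℤ) + 2 * M - btilde' L M η j - btilde' L M η (j + 1)).toNat

def wordStart' (L M : ℕ) (η : ℕ → ℤ) (j : ℕ) : ℕ :=
  ∑ k ∈ Finset.range j, wordLen' L M η k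

/-- Primed raised soliton word sequence `d̃′(η)`. -/
def dTilde' (L M : ℕ) (η : ℕ → ℤ) (n : ℕ) : ℤ :=
  if ∃ j, wordStart' L M η j ≤ n ∧ n < wordStart' L M η (j + 1) ∧
      ((j ∈ Iset' (L : ℤ) η ∧
          (L : ℤ) + 2 * M - (η j + M) ≤ ((n - wordStart' L M η j : ℕ) : ℤ)) ∨
        (j ∉ Iset' (L : ℤ) η ∧
          ((n - wordStart' L M η j : ℕ) : ℤ) < η j + M - btilde' L M η j))
  then 1 else 0

/-- The sequence `0^{s 1}1^{t 1}0^{s 2}1^{t 2}⋯0^{s N}1^{t N}0^∞`. -/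
def runSeq (N : ℕ) (s t : ℕ → ℕ) (n : ℕ) : ℤ :=
  if ∃ m, 1 ≤ m ∧ m ≤ N ∧
      (∑ k ∈ Finset.Icc 1 (m - 1), (s k + t k)) + s m ≤ n ∧
      n < ∑ k ∈ Finset.Icc 1 m, (s k + t k)
  then 1 else 0

/-- `w = 0^{s 1}1^{t 1}⋯1^{t N}0^∞` is the (maximal) run decomposition of `w`. -/
def IsRunDecomp (N : ℕ) (s t : ℕ → ℕ) (w : ℕ → ℤ) : Prop :=
  (∀ m, 1 ≤ m → m ≤ N → 1 ≤ t m) ∧ (∀ m, 2 ≤ m → m ≤ N → 1 ≤ s m) ∧ w = runSeq N s t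

def shrinkS (M : ℕ) (s : ℕ → ℕ) (m : ℕ) : ℕ := if m = 1 then s 1 - M else s m - 2 * M

def shrinkT (M : ℕ) (t : ℕ → ℕ) (m : ℕ) : ℕ := t m - 2 * M

/-- `d` is the soliton sequence `d(η)`. -/
def IsSolitonSeq (L M : ℕ) (η : ℕ → ℤ) (d : ℕ → ℤ) : Prop :=
  ∃ N s t, IsRunDecomp N s t (dTilde L M η) ∧ d = runSeq N (shrinkS M s) (shrinkT M t)

/-- `d` is the primed soliton sequence `d′(η)`. -/
def IsSolitonSeq' (L M : ℕ) (η : ℕ → ℤ) (d : ℕ → ℤ) : Prop :=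
  ∃ N s t, IsRunDecomp N s t (dTilde' L M η) ∧ d = runSeq N (shrinkS M s) (shrinkT M t)

/-- Forward shift `Λ`. -/
def lam (c : ℕ → ℤ) : ℕ → ℤ
  | 0 => 0
  | j + 1 => c j

/-- Membership in the background space `S^{(b)}_{L,M}`. -/
def mem_Sb (L M : ℤ) (c : ℕ → ℤ) : Prop := mem_S L M c ∧ ∀ j, c j + c (j + 1) ≤ L

/-- Membership in the soliton space `S^{(f)}_L`: a binary sequence with finitely many
ones all of whose maximal runs of equal letters have length greater than `L`. -/
def mem_Sf (L : ℕ) (w : ℕ → ℤ) : Prop :=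
  (∀ n, w n = 0 ∨ w n = 1) ∧ (∃ N : ℕ, ∀ n, N ≤ n → w n = 0) ∧
  ∀ n m : ℕ, n ≤ m → (∀ j, n ≤ j → j ≤ m → w j = w n) →
    (n = 0 ∨ w (n - 1) ≠ w n) → w (m + 1) ≠ w m → L < m + 1 - n

/-- Stages of the iterative arc-pairing construction: at each stage, connect every pair
`i < j` of yet-unpaired positions with `w i = a`, `w j = b` such that every position
strictly between them is already paired. -/
def arcStage (a b : ℤ) (w : ℕ → ℤ) : ℕ → Set (ℕ × ℕ)
  | 0 => ∅
  | k + 1 => arcStage a b w k ∪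
      {p : ℕ × ℕ | p.1 < p.2 ∧ w p.1 = a ∧ w p.2 = b ∧
        (∀ q ∈ arcStage a b w k, p.1 ≠ q.1 ∧ p.1 ≠ q.2 ∧ p.2 ≠ q.1 ∧ p.2 ≠ q.2) ∧
        (∀ m, p.1 < m → m < p.2 → ∃ q ∈ arcStage a b w k, m = q.1 ∨ m = q.2)}

/-- The arc pairing: `arcPairing 1 0 w` is the 10-arc pairing of `w`, and
`arcPairing 0 1 w` is the 01-arc pairing of `w`. -/
def arcPairing (a b : ℤ) (w : ℕ → ℤ) : Set (ℕ × ℕ) := ⋃ k, arcStage a b w k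

/-- Extension of `η` to integer indices with `η_j = L` for `j < 0`. -/
def etaExt (L : ℕ) (η : ℕ → ℤ) (j : ℤ) : ℤ := if j < 0 then (L : ℤ) else η j.toNat

end

end BBS

namespace BBS

/-! ### Run decompositions -/

/-- End of the `m`-th block. -/
def runEnd (s t : ℕ → ℕ) (m : ℕ) : ℕ := ∑ k ∈ Finset.Icc 1 m, (s k + t k)

theorem runEnd_zero (s t : ℕ → ℕ) : runEnd s t 0 = 0 := by simp [runEnd]

theorem runEnd_succ (s t : ℕ → ℕ) (m : ℕ) :
    runEnd s t (m + 1) = runEnd s t m + s (m + 1) + t (m + 1) := by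
  unfold runEnd
  rw [Finset.sum_Icc_succ_top (by omega)]; omega

theorem runEnd_mono (s t : ℕ → ℕ) : Monotone (runEnd s t) :=
  monotone_nat_of_le_succ (fun m => by rw [runEnd_succ]; omega)

theorem runSeq_eq_one_iff (N : ℕ) (s t : ℕ → ℕ) (n : ℕ) :
    runSeq N s t n = 1 ↔
      ∃ m, m < N ∧ runEnd s t m + s (m + 1) ≤ n ∧ n < runEnd s t (m + 1) := by
  unfold runSeq
  constructor
  · intro h
    split_ifs at h with hh
    · obtain ⟨m, h1, h2, h3, h4⟩ := hh
      obtain ⟨k, rfl⟩ : ∃ k, m = k + 1 := ⟨m - 1, by omega⟩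
      exact ⟨k, by omega, by simpa [runEnd] using h3, by simpa [runEnd] using h4⟩
    · omega
  · rintro ⟨m, h1, h2, h3⟩
    rw [if_pos]
    exact ⟨m + 1, by omega, by omega, by simpa [runEnd] using h2, by simpa [runEnd] using h3⟩

theorem runSeq_zero_or_one (N : ℕ) (s t : ℕ → ℕ) (n : ℕ) :
    runSeq N s t n = 0 ∨ runSeq N s t n = 1 := by
  unfold runSeq
  split_ifs <;> simp

theorem runSeq_ones {N : ℕ} {s t : ℕ → ℕ} {m n : ℕ} (hm : m < N)
    (h1 : runEnd s t m + s (m + 1) ≤ n) (h2 : n < runEnd s t (m + 1)) :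
    runSeq N s t n = 1 := (runSeq_eq_one_iff _ _ _ _).2 ⟨m, hm, h1, h2⟩

theorem runSeq_zeros {N : ℕ} {s t : ℕ → ℕ} {m n : ℕ}
    (h1 : runEnd s t m ≤ n) (h2 : n < runEnd s t m + s (m + 1)) :
    runSeq N s t n = 0 := by
  rcases runSeq_zero_or_one N s t n with h | h
  · exact h
  exfalso
  obtain ⟨k, hk, h3, h4⟩ := (runSeq_eq_one_iff _ _ _ _).1 h
  rcases lt_trichotomy k m with hkm | hkm | hkm
  · have := runEnd_mono s t (show k + 1 ≤ m by omega)
    omega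
  · subst hkm; omega
  · have := runEnd_mono s t (show m + 1 ≤ k by omega)
    rw [runEnd_succ] at this
    omega

theorem runSeq_beyond {N : ℕ} {s t : ℕ → ℕ} {n : ℕ}
    (h1 : runEnd s t N ≤ n) : runSeq N s t n = 0 := by
  rcases runSeq_zero_or_one N s t n with h | h
  · exact h
  exfalso
  obtain ⟨k, hk, h3, h4⟩ := (runSeq_eq_one_iff _ _ _ _).1 h
  have := runEnd_mono s t (show k + 1 ≤ N by omega)
  omega

theorem runSeq_end {N : ℕ} {s t : ℕ → ℕ} (hs : ∀ m, 2 ≤ m → m ≤ N → 1 ≤ s m)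
    {m : ℕ} (hm : m < N) : runSeq N s t (runEnd s t (m + 1)) = 0 := by
  by_cases h : m + 1 = N
  · exact runSeq_beyond (by rw [h])
  · exact runSeq_zeros (m := m + 1) le_rfl (by have := hs (m + 1 + 1) (by omega) (by omega); omega)

theorem run_unique_aux {N N' : ℕ} {s t s' t' : ℕ → ℕ}
    (ht : ∀ m, 1 ≤ m → m ≤ N → 1 ≤ t m) (hs : ∀ m, 2 ≤ m → m ≤ N → 1 ≤ s m)
    (ht' : ∀ m, 1 ≤ m → m ≤ N' → 1 ≤ t' m) (hs' : ∀ m, 2 ≤ m → m ≤ N' → 1 ≤ s' m)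
    (h : runSeq N s t = runSeq N' s' t') (m : ℕ) (hm : m ≤ N) (hm' : m ≤ N') :
    runEnd s t m = runEnd s' t' m ∧ ∀ k, 1 ≤ k → k ≤ m → s k = s' k ∧ t k = t' k := by
  induction m with
  | zero => exact ⟨by simp [runEnd_zero], fun k h1 h2 => by omega⟩
  | succ m ih =>
    obtain ⟨hA, hk⟩ := ih (by omega) (by omega)
    have e1 := runEnd_succ s t m
    have e2 := runEnd_succ s' t' m
    have p1 := ht (m + 1) (by omega) hm
    have p2 := ht' (m + 1) (by omega) hm'
    have hss : s (m + 1) = s' (m + 1) := by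
      rcases lt_trichotomy (s (m + 1)) (s' (m + 1)) with hlt | heq | hlt
      · have a1 := runSeq_ones (s := s) (t := t) (N := N) (m := m)
          (n := runEnd s t m + s (m + 1)) (by omega) le_rfl (by omega)
        have a2 := runSeq_zeros (s := s') (t := t') (N := N') (m := m)
          (n := runEnd s t m + s (m + 1)) (by omega) (by omega)
        rw [h] at a1; omega
      · exact heq
      · have a1 := runSeq_ones (s := s') (t := t') (N := N') (m := m)
          (n := runEnd s' t' m + s' (m + 1)) (by omega) le_rfl (by omega)
        have a2 := runSeq_zeros (s := s) (t := t) (N := N) (m := m)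
          (n := runEnd s' t' m + s' (m + 1)) (by omega) (by omega)
        rw [h] at a2; omega
    have htt : t (m + 1) = t' (m + 1) := by
      rcases lt_trichotomy (t (m + 1)) (t' (m + 1)) with hlt | heq | hlt
      · have a1 := runSeq_end (t := t) hs (m := m) (by omega)
        have a2 := runSeq_ones (s := s') (t := t') (N := N') (m := m)
          (n := runEnd s t (m + 1)) (by omega) (by omega) (by omega)
        rw [h] at a1; omega
      · exact heq
      · have a1 := runSeq_end (t := t') hs' (m := m) (by omega)
        have a2 := runSeq_ones (s := s) (t := t) (N := N) (m := m)
          (n := runEnd s' t' (m + 1)) (by omega) (by omega) (by omega)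
        rw [h] at a2; omega
    refine ⟨by omega, fun k h1 h2 => ?_⟩
    by_cases hkm : k = m + 1
    · subst hkm; exact ⟨hss, htt⟩
    · exact hk k h1 (by omega)

theorem run_unique_le {N N' : ℕ} {s t s' t' : ℕ → ℕ}
    (ht : ∀ m, 1 ≤ m → m ≤ N → 1 ≤ t m) (hs : ∀ m, 2 ≤ m → m ≤ N → 1 ≤ s m)
    (ht' : ∀ m, 1 ≤ m → m ≤ N' → 1 ≤ t' m) (hs' : ∀ m, 2 ≤ m → m ≤ N' → 1 ≤ s' m)
    (h : runSeq N s t = runSeq N' s' t') : N' ≤ N := by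
  by_contra hlt
  push Not at hlt
  have hA := (run_unique_aux ht hs ht' hs' h N le_rfl hlt.le).1
  have e2 := runEnd_succ s' t' N
  have p2 := ht' (N + 1) (by omega) hlt
  have a1 := runSeq_ones (s := s') (t := t') (N := N') (m := N)
    (n := runEnd s' t' N + s' (N + 1)) hlt le_rfl (by omega)
  have a2 := runSeq_beyond (s := s) (t := t) (N := N)
    (n := runEnd s' t' N + s' (N + 1)) (by omega)
  rw [h] at a2; omega

/-- Long runs: the properties of `d̃` needed to undo the shrinking. -/
def LongRuns (M K : ℕ) (w : ℕ → ℤ) : Prop :=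
  (∀ B, w B = 1 → (B = 0 ∨ w (B - 1) = 0) → ∀ n, B ≤ n → n < B + K → w n = 1) ∧
  (∀ A, w A = 1 → w (A + 1) = 0 → ∀ n, A + 1 ≤ n → n < A + 1 + K → w n = 0) ∧
  (∀ n, n < M → w n = 0)

theorem longRuns_bounds {M K N : ℕ} {s t : ℕ → ℕ} {w : ℕ → ℤ} (hw : LongRuns M K w)
    (hd : IsRunDecomp N s t w) :
    (∀ m, 1 ≤ m → m ≤ N → K ≤ t m) ∧ (∀ m, 2 ≤ m → m ≤ N → K ≤ s m) ∧
      (1 ≤ N → M ≤ s 1) := by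
  obtain ⟨ht, hs, rfl⟩ := hd
  obtain ⟨hU, hD, hZ⟩ := hw
  have hone : ∀ m, m < N → runSeq N s t (runEnd s t m + s (m + 1)) = 1 := fun m hm =>
    runSeq_ones hm le_rfl (by
      have := ht (m + 1) (by omega) hm
      rw [runEnd_succ]; omega)
  refine ⟨?_, ?_, ?_⟩
  · intro m h1 h2
    obtain ⟨m, rfl⟩ : ∃ k, m = k + 1 := ⟨m - 1, by omega⟩
    have e := runEnd_succ s t m
    by_contra hlt
    push Not at hlt
    have := hU _ (hone m h2) (by
      by_cases h0 : s (m + 1) = 0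
      · left
        have : m = 0 := by
          by_contra hm0
          have := hs (m + 1) (by omega) h2
          omega
        subst this
        rw [runEnd_zero, h0]
      · right
        exact runSeq_zeros (m := m) (by omega) (by omega)) (runEnd s t (m + 1))
          (by omega) (by omega)
    have h3 := runSeq_end (t := t) hs (m := m) h2
    omega
  · intro m h1 h2
    obtain ⟨m, rfl⟩ : ∃ k, m = k + 1 + 1 := ⟨m - 2, by omega⟩
    by_contra hlt
    push Not at hlt
    have e := runEnd_succ s t m
    have p := ht (m + 1) (by omega) (by omega)
    have h3 := runSeq_end (t := t) hs (m := m) (by omega)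
    have hx : runEnd s t (m + 1) - 1 + 1 = runEnd s t (m + 1) := by omega
    have := hD (runEnd s t (m + 1) - 1) (runSeq_ones (m := m) (by omega) (by omega) (by omega))
      (by rw [hx]; exact h3) (runEnd s t (m + 1) + s (m + 1 + 1)) (by omega) (by omega)
    have := hone (m + 1) (by omega)
    omega
  · intro hN
    have h1 := hone 0 hN
    rw [runEnd_zero] at h1
    by_contra hlt
    have := hZ (0 + s (0 + 1)) (by simpa using hlt)
    omega

theorem unshrink {M K : ℕ} {w w' d : ℕ → ℤ} (hK : 2 * M < K)
    (hw : LongRuns M K w) (hw' : LongRuns M K w')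
    (h : ∃ N s t, IsRunDecomp N s t w ∧ d = runSeq N (shrinkS M s) (shrinkT M t))
    (h' : ∃ N s t, IsRunDecomp N s t w' ∧ d = runSeq N (shrinkS M s) (shrinkT M t)) :
    w = w' := by
  obtain ⟨N, s, t, hd, e⟩ := h
  obtain ⟨N', s', t', hd', e'⟩ := h'
  obtain ⟨b1, b2, b3⟩ := longRuns_bounds hw hd
  obtain ⟨b1', b2', b3'⟩ := longRuns_bounds hw' hd'
  have hh := e.symm.trans e'
  have p1 : ∀ m, 1 ≤ m → m ≤ N → 1 ≤ shrinkT M t m := fun m h1 h2 => by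
    have := b1 m h1 h2; unfold shrinkT; omega
  have p1' : ∀ m, 1 ≤ m → m ≤ N' → 1 ≤ shrinkT M t' m := fun m h1 h2 => by
    have := b1' m h1 h2; unfold shrinkT; omega
  have p2 : ∀ m, 2 ≤ m → m ≤ N → 1 ≤ shrinkS M s m := fun m h1 h2 => by
    have := b2 m h1 h2; unfold shrinkS; rw [if_neg (by omega)]; omega
  have p2' : ∀ m, 2 ≤ m → m ≤ N' → 1 ≤ shrinkS M s' m := fun m h1 h2 => by
    have := b2' m h1 h2; unfold shrinkS; rw [if_neg (by omega)]; omega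
  have hN : N = N' := le_antisymm (run_unique_le p1' p2' p1 p2 hh.symm)
    (run_unique_le p1 p2 p1' p2' hh)
  subst hN
  have key := (run_unique_aux p1 p2 p1' p2' hh N le_rfl le_rfl).2
  have hst : ∀ k, 1 ≤ k → k ≤ N → s k = s' k ∧ t k = t' k := by
    intro k h1 h2
    obtain ⟨k1, k2⟩ := key k h1 h2
    have := b1 k h1 h2
    have := b1' k h1 h2
    unfold shrinkT at k2
    unfold shrinkS at k1
    refine ⟨?_, by omega⟩
    by_cases hk : k = 1
    · subst hk
      rw [if_pos rfl, if_pos rfl] at k1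
      have := b3 h2
      have := b3' h2
      omega
    · rw [if_neg hk, if_neg hk] at k1
      have := b2 k (by omega) h2
      have := b2' k (by omega) h2
      omega
  have hE : ∀ m, m ≤ N → runEnd s t m = runEnd s' t' m := by
    intro m hm
    unfold runEnd
    apply Finset.sum_congr rfl
    intro k hk
    rw [Finset.mem_Icc] at hk
    obtain ⟨k1, k2⟩ := hst k hk.1 (by omega)
    rw [k1, k2]
  rw [hd.2.2, hd'.2.2]
  funext n
  have : runSeq N s t n = 1 ↔ runSeq N s' t' n = 1 := by
    rw [runSeq_eq_one_iff, runSeq_eq_one_iff]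
    refine exists_congr fun m => and_congr_right fun hm => ?_
    rw [hE m hm.le, hE (m + 1) hm, (hst (m + 1) (by omega) hm).1]
  rcases runSeq_zero_or_one N s t n with h1 | h1 <;>
    rcases runSeq_zero_or_one N s' t' n with h2 | h2 <;> simp_all

/-! ### Flags, arc counts and words -/

/-- The part of `mem_S` used in the proof. -/
def Good (L M : ℕ) (η : ℕ → ℤ) : Prop :=
  1 ≤ L ∧ (∃ N : ℕ, ∀ j, N ≤ j → η j = 0) ∧
  (∀ j, -(M : ℤ) ≤ η j ∧ η j ≤ L + M) ∧ η 0 ≤ 0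

theorem flag_zero_or_one (L : ℤ) (η : ℕ → ℤ) (j : ℕ) : flag L η j = 0 ∨ flag L η j = 1 := by
  induction j with
  | zero => left; rfl
  | succ j ih => rw [flag]; split_ifs <;> simp_all

theorem flag_succ_one {L : ℤ} {η : ℕ → ℤ} {j : ℕ} (h : flag L η (j + 1) = 1) :
    L ≤ η j + η (j + 1) := by
  rw [flag] at h; split_ifs at h <;> omega

theorem flag_succ_zero {L : ℤ} {η : ℕ → ℤ} {j : ℕ} (h : flag L η (j + 1) = 0) :
    η j + η (j + 1) ≤ L := by
  rw [flag] at h; split_ifs at h <;> omega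

theorem Iset_lt {L : ℤ} {η : ℕ → ℤ} {q : ℕ} (h : q ∈ Iset L η) : η q + η (q + 1) < L := by
  obtain ⟨h1, h2⟩ := h
  rw [flag] at h2; split_ifs at h2 <;> omega

theorem Iset_pos {L : ℤ} {η : ℕ → ℤ} {q : ℕ} (h : q ∈ Iset L η) :
    ∃ r, q = r + 1 ∧ L ≤ η r + η q := by
  obtain ⟨h1, h2⟩ := h
  cases q with
  | zero => simp [flag] at h1
  | succ r => exact ⟨r, rfl, flag_succ_one h1⟩

theorem Iset_succ {L : ℤ} {η : ℕ → ℤ} {q : ℕ} (h : q ∈ Iset L η) : q + 1 ∉ Iset L η := by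
  rintro ⟨h1, h2⟩
  obtain ⟨h3, h4⟩ := h
  omega

theorem btilde_bounds {L M : ℕ} {η : ℕ → ℤ} (hg : Good L M η) (j : ℕ) :
    0 ≤ btilde L M η j ∧ btilde L M η j ≤ η j + M ∧ btilde L M η j ≤ L + M - η (j + 1) := by
  have h1 := hg.2.2.1 j
  have h2 := hg.2.2.1 (j + 1)
  unfold btilde
  split_ifs <;> omega

theorem bprev_bounds {L M : ℕ} {η : ℕ → ℤ} (hg : Good L M η) (j : ℕ) :
    0 ≤ bprev L M η j ∧ bprev L M η j ≤ L + M - η j := by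
  cases j with
  | zero =>
    have h1 := hg.2.2.1 0
    simp only [bprev]; omega
  | succ j =>
    have := btilde_bounds hg j
    simp only [bprev]; omega

theorem btilde_marked {L M : ℕ} {η : ℕ → ℤ} {j : ℕ} (h : marked (L : ℤ) η j) :
    btilde L M η j = 0 := by
  unfold btilde; rw [if_pos h]

theorem bprev_Iset {L M : ℕ} {η : ℕ → ℤ} {q : ℕ} (h : q ∈ Iset (L : ℤ) η) :
    bprev L M η q = 0 := by
  cases q with
  | zero => rfl
  | succ r => exact btilde_marked (Or.inr h)

theorem wordStart_succ {L M : ℕ} {η : ℕ → ℤ} (hg : Good L M η) (j : ℕ) :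
    (wordStart L M η (j + 1) : ℤ) =
      wordStart L M η j + (L + 2 * M - bprev L M η j - btilde L M η j) := by
  have h1 := btilde_bounds hg j
  have h2 := bprev_bounds hg j
  unfold wordStart
  rw [Finset.sum_range_succ]
  unfold wordLen
  split_ifs with h
  · rw [bprev_Iset h, btilde_marked (Or.inl h)]; push_cast; ring
  · have h3 : (0 : ℤ) ≤ (L : ℤ) + 2 * M - bprev L M η j - btilde L M η j := by omega
    rw [Nat.cast_add, Int.toNat_of_nonneg h3]

theorem wordStart_mono {L M : ℕ} {η : ℕ → ℤ} : Monotone (wordStart L M η) :=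
  monotone_nat_of_le_succ (fun m => by
    unfold wordStart; rw [Finset.sum_range_succ]; omega)

theorem dTilde_zero_or_one (L M : ℕ) (η : ℕ → ℤ) (n : ℕ) :
    dTilde L M η n = 0 ∨ dTilde L M η n = 1 := by
  unfold dTilde; split_ifs <;> simp

theorem dTilde_one_iff {L M : ℕ} {η : ℕ → ℤ} (n : ℕ) :
    dTilde L M η n = 1 ↔ ∃ j, wordStart L M η j ≤ n ∧ n < wordStart L M η (j + 1) ∧
      ((j ∈ Iset (L : ℤ) η ∧ (n : ℤ) < wordStart L M η j + (η j + M)) ∨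
        (j ∉ Iset (L : ℤ) η ∧
          wordStart L M η j + (L + M - η j - bprev L M η j) ≤ (n : ℤ))) := by
  unfold dTilde
  constructor
  · intro h
    split_ifs at h with hh
    · obtain ⟨j, h1, h2, h3⟩ := hh
      refine ⟨j, h1, h2, ?_⟩
      push_cast [h1] at h3
      rcases h3 with ⟨h3, h4⟩ | ⟨h3, h4⟩
      · left; exact ⟨h3, by omega⟩
      · right; exact ⟨h3, by omega⟩
    · omega
  · rintro ⟨j, h1, h2, h3⟩
    rw [if_pos]
    refine ⟨j, h1, h2, ?_⟩
    push_cast [h1]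
    rcases h3 with ⟨h3, h4⟩ | ⟨h3, h4⟩
    · left; exact ⟨h3, by omega⟩
    · right; exact ⟨h3, by omega⟩

theorem word_unique {L M : ℕ} {η : ℕ → ℤ} {j k n : ℕ}
    (h1 : wordStart L M η j ≤ n) (h2 : n < wordStart L M η (j + 1))
    (h3 : wordStart L M η k ≤ n) (h4 : n < wordStart L M η (k + 1)) : j = k := by
  rcases lt_trichotomy j k with h | h | h
  · have := wordStart_mono (L := L) (M := M) (η := η) (show j + 1 ≤ k by omega); omega
  · exact h
  · have := wordStart_mono (L := L) (M := M) (η := η) (show k + 1 ≤ j by omega); omega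

theorem dTilde_in_I {L M : ℕ} {η : ℕ → ℤ} {j n : ℕ} (hj : j ∈ Iset (L : ℤ) η)
    (h1 : wordStart L M η j ≤ n) (h2 : n < wordStart L M η (j + 1)) :
    dTilde L M η n = 1 ↔ (n : ℤ) < wordStart L M η j + (η j + M) := by
  rw [dTilde_one_iff]
  constructor
  · rintro ⟨k, h3, h4, h5⟩
    obtain rfl := word_unique h1 h2 h3 h4
    rcases h5 with h5 | h5
    · exact h5.2
    · exact absurd hj h5.1
  · intro h; exact ⟨j, h1, h2, Or.inl ⟨hj, h⟩⟩

theorem dTilde_notin_I {L M : ℕ} {η : ℕ → ℤ} {j n : ℕ} (hj : j ∉ Iset (L : ℤ) η)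
    (h1 : wordStart L M η j ≤ n) (h2 : n < wordStart L M η (j + 1)) :
    dTilde L M η n = 1 ↔ wordStart L M η j + (L + M - η j - bprev L M η j) ≤ (n : ℤ) := by
  rw [dTilde_one_iff]
  constructor
  · rintro ⟨k, h3, h4, h5⟩
    obtain rfl := word_unique h1 h2 h3 h4
    rcases h5 with h5 | h5
    · exact absurd h5.1 hj
    · exact h5.2
  · intro h; exact ⟨j, h1, h2, Or.inr ⟨hj, h⟩⟩

/-- Ones before and zeros after the end of the soliton attached to `q ∈ I`. -/
theorem around_end {L M : ℕ} {η : ℕ → ℤ} (hg : Good L M η) {q : ℕ}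
    (hq : q ∈ Iset (L : ℤ) η) :
    ((L : ℤ) + 2 * M ≤ wordStart L M η q + (η q + M)) ∧
    (∀ n : ℕ, (wordStart L M η q : ℤ) + (η q + M) - (L + 2 * M) ≤ n →
      (n : ℤ) < wordStart L M η q + (η q + M) → dTilde L M η n = 1) ∧
    (∀ n : ℕ, (wordStart L M η q : ℤ) + (η q + M) ≤ n →
      (n : ℤ) < wordStart L M η q + (η q + M) + (L + 2 * M) → dTilde L M η n = 0) := by
  obtain ⟨r, rfl, hr⟩ := Iset_pos hq
  have hlt := Iset_lt hq
  have e0 := wordStart_succ hg r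
  have e1 := wordStart_succ hg (r + 1)
  have e2 := wordStart_succ hg (r + 1 + 1)
  have hr' : r ∉ Iset (L : ℤ) η := fun h => Iset_succ h hq
  have hq' := Iset_succ hq
  have b0 : btilde L M η r = 0 := btilde_marked (Or.inr hq)
  have b1 : btilde L M η (r + 1) = 0 := btilde_marked (Or.inl hq)
  have c0 := bprev_bounds hg r
  have c1 : bprev L M η (r + 1) = 0 := b0
  have c2 : bprev L M η (r + 1 + 1) = 0 := b1
  have d2 := btilde_bounds hg (r + 1 + 1)
  have g0 := hg.2.2.1 r
  have g1 := hg.2.2.1 (r + 1)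
  have g2 := hg.2.2.1 (r + 1 + 1)
  refine ⟨by omega, ?_, ?_⟩
  · intro n h1 h2
    by_cases hn : wordStart L M η (r + 1) ≤ n
    · rw [dTilde_in_I hq hn (by omega)]; omega
    · rw [dTilde_notin_I hr' (by omega) (by omega)]; omega
  · intro n h1 h2
    rcases dTilde_zero_or_one L M η n with h | h
    · exact h
    exfalso
    by_cases hn : n < wordStart L M η (r + 1 + 1)
    · rw [dTilde_in_I hq (by omega) hn] at h; omega
    · rw [dTilde_notin_I hq' (by omega) (by omega)] at h; omega

theorem flag_eventually {L M : ℕ} {η : ℕ → ℤ} (hg : Good L M η) :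
    ∃ N, ∀ j, N ≤ j → flag (L : ℤ) η j = 0 := by
  obtain ⟨hL, ⟨N, hN⟩, -⟩ := hg
  refine ⟨N + 1, fun j hj => ?_⟩
  obtain ⟨k, rfl⟩ : ∃ k, j = k + 1 := ⟨j - 1, by omega⟩
  rw [flag, if_pos]
  rw [hN k (by omega), hN (k + 1) (by omega)]; omega

theorem flag_one_run {L M : ℕ} {η : ℕ → ℤ} (hg : Good L M η) {N : ℕ}
    (hN : ∀ j, N ≤ j → flag (L : ℤ) η j = 0) (k i : ℕ) (hk : N ≤ i + k)
    (hi : flag (L : ℤ) η i = 1) :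
    ∃ q ∈ Iset (L : ℤ) η, i ≤ q ∧ ∀ n : ℕ, wordStart L M η i ≤ n →
      (n : ℤ) < wordStart L M η q + (η q + M) → dTilde L M η n = 1 := by
  induction k generalizing i with
  | zero => have := hN i (by omega); omega
  | succ k ih =>
    rcases flag_zero_or_one (L : ℤ) η (i + 1) with h | h
    · have hq : i ∈ Iset (L : ℤ) η := ⟨hi, h⟩
      refine ⟨i, hq, le_rfl, fun n h1 h2 => ?_⟩
      have e1 := wordStart_succ hg i
      have b1 : btilde L M η i = 0 := btilde_marked (Or.inl hq)
      have c1 : bprev L M η i = 0 := bprev_Iset hq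
      have g1 := hg.2.2.1 i
      rw [dTilde_in_I hq h1 (by omega)]
      exact h2
    · obtain ⟨q, hq, hiq, hones⟩ := ih (i + 1) (by omega) h
      refine ⟨q, hq, by omega, fun n h1 h2 => ?_⟩
      by_cases hn : wordStart L M η (i + 1) ≤ n
      · exact hones n hn h2
      have hni : i ∉ Iset (L : ℤ) η := fun hh => by have := hh.2; omega
      rw [dTilde_notin_I hni h1 (by omega)]
      have : bprev L M η i = L + M - η i := by
        cases i with
        | zero => simp [flag] at hi
        | succ r =>
          have hs := flag_succ_one hi
          have hnm : ¬ marked (L : ℤ) η r := by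
            rintro (hh | hh)
            · have := hh.2; omega
            · exact hni hh
          simp only [bprev, btilde]
          rw [if_neg hnm]; omega
      omega

theorem one_run {L M : ℕ} {η : ℕ → ℤ} (hg : Good L M η) {n : ℕ} (h : dTilde L M η n = 1) :
    ∃ q ∈ Iset (L : ℤ) η, (n : ℤ) < wordStart L M η q + (η q + M) ∧
      ∀ m : ℕ, n ≤ m → (m : ℤ) < wordStart L M η q + (η q + M) → dTilde L M η m = 1 := by
  obtain ⟨N, hN⟩ := flag_eventually hg
  obtain ⟨j, h1, h2, h3⟩ := (dTilde_one_iff n).1 h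
  rcases h3 with ⟨hj, h3⟩ | ⟨hj, h3⟩
  · refine ⟨j, hj, h3, fun m hm hm' => ?_⟩
    have e1 := wordStart_succ hg j
    have b1 : btilde L M η j = 0 := btilde_marked (Or.inl hj)
    have c1 : bprev L M η j = 0 := bprev_Iset hj
    have g1 := hg.2.2.1 j
    rw [dTilde_in_I hj (by omega) (by omega)]; exact hm'
  · have e1 := wordStart_succ hg j
    have hf : flag (L : ℤ) η (j + 1) = 1 := by
      rcases flag_zero_or_one (L : ℤ) η (j + 1) with hf | hf
      · exfalso
        have hs := flag_succ_zero hf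
        have hnm : ¬ marked (L : ℤ) η j := by
          rintro (hh | hh)
          · exact hj hh
          · have := hh.1; omega
        have : btilde L M η j = η j + M := by
          simp only [btilde]; rw [if_neg hnm]; omega
        omega
      · exact hf
    obtain ⟨q, hq, hiq, hones⟩ := flag_one_run hg hN N (j + 1) (by omega) hf
    have hm := wordStart_mono (L := L) (M := M) (η := η) hiq
    have g := hg.2.2.1 q
    refine ⟨q, hq, by omega, fun m hm1 hm2 => ?_⟩
    by_cases hmm : wordStart L M η (j + 1) ≤ m
    · exact hones m hmm hm2
    · rw [dTilde_notin_I hj (by omega) (by omega)]; omega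

theorem descent {L M : ℕ} {η : ℕ → ℤ} (hg : Good L M η) {n : ℕ}
    (h : dTilde L M η n = 1) (h' : dTilde L M η (n + 1) = 0) :
    ∃ q ∈ Iset (L : ℤ) η, (n : ℤ) + 1 = wordStart L M η q + (η q + M) := by
  obtain ⟨q, hq, h1, h2⟩ := one_run hg h
  refine ⟨q, hq, ?_⟩
  by_contra hne
  have := h2 (n + 1) (by omega) (by push_cast; omega)
  omega

theorem dTilde_longRuns {L M : ℕ} {η : ℕ → ℤ} (hg : Good L M η) :
    LongRuns M (L + 2 * M) (dTilde L M η) := by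
  refine ⟨?_, ?_, ?_⟩
  · intro B h1 h2 n h3 h4
    obtain ⟨q, hq, h5, h6⟩ := one_run hg h1
    obtain ⟨a1, a2, a3⟩ := around_end hg hq
    apply h6 n h3
    by_contra hlt
    rcases h2 with h2 | h2
    · omega
    · by_cases hB : B = 0
      · omega
      · have := a2 (B - 1) (by omega) (by omega)
        omega
  · intro A h1 h2 n h3 h4
    obtain ⟨q, hq, h5⟩ := descent hg h1 h2
    obtain ⟨a1, a2, a3⟩ := around_end hg hq
    exact a3 n (by omega) (by omega)
  · intro n hn
    rcases dTilde_zero_or_one L M η n with h | h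
    · exact h
    exfalso
    have hj : (0 : ℕ) ∉ Iset (L : ℤ) η := fun h => by have := h.1; simp [flag] at this
    have e := wordStart_succ hg 0
    have w0 : wordStart L M η 0 = 0 := by simp [wordStart]
    have b := btilde_bounds hg 0
    have c : bprev L M η 0 = 0 := rfl
    have g := hg.2.2.2
    have hL := hg.1
    rw [dTilde_notin_I hj (by omega) (by omega)] at h
    omega

/-! ### Comparing two states -/

theorem unmarked_infinite {L M : ℕ} {η : ℕ → ℤ} (hg : Good L M η) (m : ℕ) :
    ∃ p, m ≤ p ∧ ¬ marked (L : ℤ) η p := by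
  obtain ⟨N, hN⟩ := flag_eventually hg
  refine ⟨m + N, by omega, ?_⟩
  rintro (h | h)
  · have := h.1; have := hN (m + N) (by omega); omega
  · have := h.1; have := hN (m + N + 1) (by omega); omega

open Classical in
theorem b_eq_of_count {L M : ℕ} {η ζ : ℕ → ℤ} (hc : bg L M η = bg L M ζ) {p p' : ℕ}
    (hp : ¬ marked (L : ℤ) η p) (hp' : ¬ marked (L : ℤ) ζ p')
    (h : Nat.count (fun i => ¬ marked (L : ℤ) η i) p =
      Nat.count (fun i => ¬ marked (L : ℤ) ζ i) p') :
    btilde L M η p = btilde L M ζ p' := by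
  have h1 := congrFun hc (Nat.count (fun i => ¬ marked (L : ℤ) η i) p)
  unfold bg at h1
  rw [Nat.nth_count (p := fun i => ¬ marked (L : ℤ) η i) hp, h,
    Nat.nth_count (p := fun i => ¬ marked (L : ℤ) ζ i) hp'] at h1
  omega

theorem count_eq {P Q : ℕ → Prop} [DecidablePred P] [DecidablePred Q] {n : ℕ} (h : ∀ i, i < n → (P i ↔ Q i)) :
    Nat.count P n = Nat.count Q n := by
  induction n with
  | zero => simp
  | succ n ih =>
    rw [Nat.count_succ, Nat.count_succ, ih (fun i hi => h i (by omega))]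
    have := h n (by omega)
    by_cases hP : P n <;> simp_all

theorem count_const {P : ℕ → Prop} [DecidablePred P] {m n : ℕ} (hmn : m ≤ n) (h : ∀ i, m ≤ i → i < n → ¬ P i) :
    Nat.count P n = Nat.count P m := by
  induction n, hmn using Nat.le_induction with
  | base => rfl
  | succ n hn ih =>
    rw [Nat.count_succ, ih (fun i h1 h2 => h i h1 (by omega)), if_neg (h n hn (by omega))]
    rfl

theorem b_agree {L M : ℕ} {η ζ : ℕ → ℤ} (hc : bg L M η = bg L M ζ) {n : ℕ}
    (h : ∀ i, i < n → (marked (L : ℤ) η i ↔ marked (L : ℤ) ζ i)) {i : ℕ} (hi : i < n) :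
    btilde L M η i = btilde L M ζ i := by
  classical
  by_cases hm : marked (L : ℤ) η i
  · rw [btilde_marked hm, btilde_marked ((h i hi).1 hm)]
  · refine b_eq_of_count hc hm (fun h' => hm ((h i hi).2 h')) ?_
    exact count_eq (fun j hj => not_congr (h j (lt_trans hj hi)))

theorem bprev_agree {L M : ℕ} {η ζ : ℕ → ℤ} {n : ℕ}
    (h : ∀ i, i < n → btilde L M η i = btilde L M ζ i) {i : ℕ} (hi : i ≤ n) :
    bprev L M η i = bprev L M ζ i := by
  cases i with
  | zero => rfl
  | succ i => exact h i (by omega)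

theorem wordStart_agree {L M : ℕ} {η ζ : ℕ → ℤ} (hg : Good L M η) (hg' : Good L M ζ) {n : ℕ}
    (h : ∀ i, i < n → btilde L M η i = btilde L M ζ i) {i : ℕ} (hi : i ≤ n) :
    wordStart L M η i = wordStart L M ζ i := by
  induction i with
  | zero => simp [wordStart]
  | succ i ih =>
    have e := wordStart_succ hg i
    have e' := wordStart_succ hg' i
    rw [ih (by omega), bprev_agree h (show i ≤ n by omega), h i (by omega)] at e
    omega

theorem next_unmarked {L : ℤ} {η : ℕ → ℤ} (k q p : ℕ) (hk : p ≤ q + k) (hqp : q < p)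
    (hq : q ∈ Iset L η) (hm : ∀ i, q ≤ i → i < p → marked L η i) (hp : ¬ marked L η p) :
    η p < L - η q := by
  induction k using Nat.strong_induction_on generalizing q with
  | _ k ih =>
    have h1 := Iset_lt hq
    by_cases hp1 : p = q + 1
    · subst hp1; omega
    have h2 : q + 1 + 1 ∈ Iset L η := by
      rcases hm (q + 1) (by omega) (by omega) with h | h
      · exact absurd h (Iset_succ hq)
      · exact h
    have h3 : q + 2 < p := by
      have : p ≠ q + 2 := by
        rintro rfl; exact hp (Or.inl h2)
      omega
    have h4 := ih (k - 2) (by omega) (q + 2) (by omega) h3 h2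
      (fun i hi hi' => hm i (by omega) hi')
    have h5 := flag_succ_one h2.1
    have : η (q + 1 + 1) = η (q + 2) := rfl
    omega

/-- The key inequality: smaller soliton end comes strictly first. -/
theorem end_lt {L M : ℕ} {η ζ : ℕ → ℤ} (hg : Good L M η) (hg' : Good L M ζ)
    (hc : bg L M η = bg L M ζ) {r : ℕ} (hq : r + 1 ∈ Iset (L : ℤ) η)
    (hq' : r + 1 ∉ Iset (L : ℤ) ζ)
    (hag : ∀ i, i < r + 1 → (i ∈ Iset (L : ℤ) η ↔ i ∈ Iset (L : ℤ) ζ))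
    {q' : ℕ} (hlt : r + 1 < q') (hI : q' ∈ Iset (L : ℤ) ζ) :
    (wordStart L M η (r + 1) : ℤ) + (η (r + 1) + M) <
      wordStart L M ζ q' + (ζ q' + M) := by
  have hmag : ∀ i, i < r → (marked (L : ℤ) η i ↔ marked (L : ℤ) ζ i) := fun i hi => by
    unfold marked; rw [hag i (by omega), hag (i + 1) (by omega)]
  have hbag : ∀ i, i < r → btilde L M η i = btilde L M ζ i := fun i hi => b_agree hc hmag hi
  have hW := wordStart_agree hg hg' hbag le_rfl
  have hP := bprev_agree (L := L) (M := M) hbag le_rfl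
  have hrη : r ∉ Iset (L : ℤ) η := fun h => Iset_succ h hq
  have hrζ : ¬ marked (L : ℤ) ζ r := by
    rintro (h | h)
    · exact hrη ((hag r (by omega)).2 h)
    · exact hq' h
  have hb : btilde L M ζ r < L + M - η (r + 1) := by
    classical
    have hex := unmarked_infinite hg r
    have hsp := Nat.find_spec hex
    have hmin : ∀ i, r ≤ i → i < Nat.find hex → marked (L : ℤ) η i := fun i h1 h2 => by
      have := Nat.find_min hex h2
      by_contra h; exact this ⟨h1, h⟩
    set p := Nat.find hex with hpdef
    have hp1 : r + 1 < p := by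
      have h1 : p ≠ r := fun h => hsp.2 (by rw [h]; exact Or.inr hq)
      have h2 : p ≠ r + 1 := fun h => hsp.2 (by rw [h]; exact Or.inl hq)
      have := hsp.1
      omega
    have hlt := next_unmarked p (r + 1) p (by omega) hp1 hq
      (fun i h1 h2 => hmin i (by omega) h2) hsp.2
    have heq : btilde L M η p = btilde L M ζ r := by
      refine b_eq_of_count hc hsp.2 hrζ ?_
      refine (count_const hsp.1 (fun i h1 h2 => not_not.2 (hmin i h1 h2))).trans ?_
      exact count_eq (fun j hj => not_congr (hmag j hj))
    have := btilde_bounds hg p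
    omega
  have e := wordStart_succ hg r
  have e' := wordStart_succ hg' r
  have b0 : btilde L M η r = 0 := btilde_marked (Or.inr hq)
  have key : ∀ i, r + 1 ≤ i → (wordStart L M η (r + 1) : ℤ) + (L + 2 * M) - btilde L M ζ r
      - bprev L M ζ i ≤ wordStart L M ζ (i + 1) + btilde L M ζ i := by
    intro i hi
    induction i, hi using Nat.le_induction with
    | base =>
      have e2 := wordStart_succ hg' (r + 1)
      have : bprev L M ζ (r + 1) = btilde L M ζ r := rfl
      omega
    | succ i hi ih =>
      have e2 := wordStart_succ hg' (i + 1)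
      have : bprev L M ζ (i + 1) = btilde L M ζ i := rfl
      have c := bprev_bounds hg' i
      have b := btilde_bounds hg' i
      omega
  obtain ⟨i, rfl, hge⟩ := Iset_pos hI
  have k := key i (by omega)
  have b1 : btilde L M ζ i = 0 := btilde_marked (Or.inr hI)
  have c := bprev_bounds hg' i
  omega

theorem I_step {L M : ℕ} {η ζ : ℕ → ℤ} (hg : Good L M η) (hg' : Good L M ζ)
    (hc : bg L M η = bg L M ζ) (hd : dTilde L M η = dTilde L M ζ) {q : ℕ}
    (hag : ∀ i, i < q → (i ∈ Iset (L : ℤ) η ↔ i ∈ Iset (L : ℤ) ζ))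
    (hq : q ∈ Iset (L : ℤ) η) : q ∈ Iset (L : ℤ) ζ := by
  by_contra hq'
  obtain ⟨r, rfl, hr⟩ := Iset_pos hq
  obtain ⟨a1, a2, a3⟩ := around_end hg hq
  have hL := hg.1
  obtain ⟨n, hn⟩ : ∃ n : ℕ, (n : ℤ) + 1 = wordStart L M η (r + 1) + (η (r + 1) + M) :=
    ⟨((wordStart L M η (r + 1) : ℤ) + (η (r + 1) + M) - 1).toNat, by omega⟩
  have h1 := a2 n (by omega) (by omega)
  have h2 := a3 (n + 1) (by push_cast; omega) (by push_cast; omega)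
  rw [hd] at h1 h2
  obtain ⟨q', hI, he⟩ := descent hg' h1 h2
  rcases lt_trichotomy q' (r + 1) with h | h | h
  · have hIη := (hag q' h).2 hI
    have hne : q' ≠ r := by rintro rfl; exact Iset_succ hIη hq
    have hmag : ∀ i, i < r → (marked (L : ℤ) η i ↔ marked (L : ℤ) ζ i) := fun i hi => by
      unfold marked; rw [hag i (by omega), hag (i + 1) (by omega)]
    have hbag : ∀ i, i < r → btilde L M η i = btilde L M ζ i := fun i hi => b_agree hc hmag hi
    have hW := wordStart_agree hg hg' hbag (show q' + 1 ≤ r by omega)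
    have hmono := wordStart_mono (L := L) (M := M) (η := η) (show q' + 1 ≤ r by omega)
    have e1 := wordStart_succ hg' q'
    have b1 : btilde L M ζ q' = 0 := btilde_marked (Or.inl hI)
    have c1 : bprev L M ζ q' = 0 := bprev_Iset hI
    have g1 := hg'.2.2.1 q'
    have e2 := wordStart_succ hg r
    have b2 : btilde L M η r = 0 := btilde_marked (Or.inr hq)
    have c2 := bprev_bounds hg r
    omega
  · subst h; exact hq' hI
  · have := end_lt hg hg' hc hq hq' hag h hI
    omega

theorem I_eq {L M : ℕ} {η ζ : ℕ → ℤ} (hg : Good L M η) (hg' : Good L M ζ)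
    (hc : bg L M η = bg L M ζ) (hd : dTilde L M η = dTilde L M ζ) (q : ℕ) :
    q ∈ Iset (L : ℤ) η ↔ q ∈ Iset (L : ℤ) ζ := by
  induction q using Nat.strong_induction_on with
  | _ q ih =>
    exact ⟨I_step hg hg' hc hd ih, I_step hg' hg hc.symm hd.symm (fun i hi => (ih i hi).symm)⟩

theorem state_le {L M : ℕ} {η ζ : ℕ → ℤ} (hg : Good L M η) (hg' : Good L M ζ)
    (hc : bg L M η = bg L M ζ) (hd : dTilde L M η = dTilde L M ζ) (j : ℕ) : ζ j ≤ η j := by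
  have hI := I_eq hg hg' hc hd
  have hb : ∀ i, i < j + 1 → btilde L M η i = btilde L M ζ i := fun i hi =>
    b_agree hc (n := j + 1) (fun i _ => by unfold marked; rw [hI, hI]) hi
  have hW := wordStart_agree hg hg' hb (show j ≤ j + 1 by omega)
  have hW1 := wordStart_agree hg hg' hb le_rfl
  have hP := bprev_agree (L := L) (M := M) hb (show j ≤ j + 1 by omega)
  have e := wordStart_succ hg j
  have e' := wordStart_succ hg' j
  have g := hg.2.2.1 j
  have g' := hg'.2.2.1 j
  have c := bprev_bounds hg j
  have c' := bprev_bounds hg' j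
  have b := btilde_bounds hg j
  have bj := hb j (by omega)
  by_contra hlt
  push Not at hlt
  by_cases hj : j ∈ Iset (L : ℤ) η
  · have b1 : btilde L M η j = 0 := btilde_marked (Or.inl hj)
    have c1 : bprev L M η j = 0 := bprev_Iset hj
    obtain ⟨n, hn⟩ : ∃ n : ℕ, (n : ℤ) = wordStart L M η j + (η j + M) :=
      ⟨((wordStart L M η j : ℤ) + (η j + M)).toNat, by omega⟩
    have h1 := dTilde_in_I (M := M) (n := n) hj (by omega) (by omega)
    have h2 := dTilde_in_I (M := M) (n := n) ((hI j).1 hj) (by omega) (by omega)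
    rw [hd, h2] at h1
    omega
  · obtain ⟨n, hn⟩ : ∃ n : ℕ,
        (n : ℤ) = wordStart L M η j + (L + M - ζ j - bprev L M ζ j) :=
      ⟨((wordStart L M η j : ℤ) + (L + M - ζ j - bprev L M ζ j)).toNat, by omega⟩
    have h1 := dTilde_notin_I (M := M) (n := n) hj (by omega) (by omega)
    have h2 := dTilde_notin_I (M := M) (n := n) (fun h => hj ((hI j).2 h)) (by omega) (by omega)
    rw [hd, h2] at h1
    omega

end BBS

open BBS

/-- Theorem 3.2: the decomposition map `β_L : η ↦ (c(η), d(η))` is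
injective. -/
theorem stmt_15 (L M : ℕ) (hL : 1 ≤ L) (η ζ : ℕ → ℤ)
    (hη : mem_S L M η) (hζ : mem_S L M ζ) (hc : bg L M η = bg L M ζ)
    (d : ℕ → ℤ) (hdη : IsSolitonSeq L M η d) (hdζ : IsSolitonSeq L M ζ d) :
    η = ζ := by
  have hg : Good L M η := ⟨hL, hη.1, hη.2.1, hη.2.2.1⟩
  have hg' : Good L M ζ := ⟨hL, hζ.1, hζ.2.1, hζ.2.2.1⟩
  have hd : dTilde L M η = dTilde L M ζ :=
    unshrink (K := L + 2 * M) (by omega) (dTilde_longRuns hg) (dTilde_longRuns hg') hdη hdζ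
  funext j
  exact le_antisymm (state_le hg' hg hc.symm hd.symm j) (state_le hg hg' hc hd j)
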